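/- arXiv:1907.12206 — 3 statements merged into one kernel-verified Lean document; each statement's English description precedes it below -/
import Mathlib

section
/- Let X be a nonempty compact subset of ℝⁿ (with n ≥ 1) whose frontier is nonempty, and let F : ℝⁿ → ℝⁿ be continuous and injective on X. If the origin 0 belongs to the image F(X), then inf_{‖λ‖=1} sup_{x∈X} λᵀF(x) ≥ inf_{x∈∂X} sup_{‖λ‖=1} λᵀF(x), where ∂X denotes the frontier of X (note that ∂X ⊆ X since X is closed). -/
open scoped RealInnerProductSpace

section InvarianceOfDomain

open MeasureTheory Metric Set
open scoped NNReal

theorem LipschitzOnWith.indicator_closedBall {E F : Type*} [NormedAddCommGroup E]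
    [NormedSpace ℝ E] [NormedAddCommGroup F] {g : E → F} {K : ℝ≥0}
    (hg : LipschitzOnWith K g (closedBall 0 1)) (h0 : ∀ x ∈ sphere (0 : E) 1, g x = 0) :
    LipschitzWith K ((closedBall (0 : E) 1).indicator g) := by
  have key : ∀ x y : E, ‖x‖ ≤ 1 → 1 < ‖y‖ → ‖g x‖ ≤ K * ‖x - y‖ := by
    intro x y hx hy
    have hc : ContinuousOn (fun t : ℝ => ‖x + t • (y - x)‖) (Icc 0 1) := by fun_prop
    obtain ⟨t, ht, hz⟩ := intermediate_value_Icc zero_le_one hc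
      (show (1 : ℝ) ∈ Icc _ _ by simpa using ⟨hx, hy.le⟩)
    have h1 := hg.dist_le_mul x (by simpa using hx) (x + t • (y - x)) (by simpa using le_of_eq hz)
    rw [h0 (x + t • (y - x)) (by simpa using hz), dist_zero_right] at h1
    refine h1.trans (mul_le_mul_of_nonneg_left ?_ K.2)
    rw [dist_self_add_right, norm_smul, Real.norm_of_nonneg ht.1, norm_sub_rev]
    exact mul_le_of_le_one_left (norm_nonneg _) ht.2
  refine LipschitzWith.of_dist_le_mul fun x y => ?_
  by_cases hx : x ∈ closedBall (0 : E) 1 <;> by_cases hy : y ∈ closedBall (0 : E) 1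
  · simpa [indicator_of_mem hx, indicator_of_mem hy] using hg.dist_le_mul x hx y hy
  · rw [indicator_of_mem hx, indicator_of_notMem hy, dist_zero_right, dist_eq_norm]
    exact key x y (by simpa using hx) (by simpa using hy)
  · rw [indicator_of_notMem hx, indicator_of_mem hy, dist_zero_left, dist_eq_norm, norm_sub_rev]
    exact key y x (by simpa using hy) (by simpa using hx)
  · rw [indicator_of_notMem hx, indicator_of_notMem hy]
    simp [mul_nonneg]

theorem LipschitzWith.bijective_add {E : Type*} [NormedAddCommGroup E] [CompleteSpace E]
    {g : E → E} {K : ℝ≥0} (hg : LipschitzWith K g) (hK : K < 1) :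
    Function.Bijective fun x => x + g x := by
  have hcontr : ∀ y, ContractingWith K fun x => y - g x := fun y =>
    ⟨hK, LipschitzWith.of_dist_le_mul fun a b => by
      simpa only [dist_sub_left] using hg.dist_le_mul a b⟩
  refine ⟨fun a b hab => ?_, fun y => ?_⟩
  · refine (hcontr (a + g a)).fixedPoint_unique' (x := a) (y := b) ?_ ?_
    · simp [Function.IsFixedPt]
    · simp only [Function.IsFixedPt] at hab ⊢
      simp [hab]
  · exact ⟨_, eq_sub_iff_add_eq.1 (hcontr y).fixedPoint_isFixedPt.symm⟩

theorem Function.Bijective.image_eq_of_forall_notMem_eq {α : Type*} {f : α → α} {s : Set α}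
    (hf : Function.Bijective f) (hs : ∀ x ∉ s, f x = x) : f '' s = s := by
  apply Subset.antisymm
  · rintro _ ⟨x, hx, rfl⟩
    by_contra h
    exact h ((hf.1 (hs _ h)).symm ▸ hx)
  · intro y hy
    obtain ⟨x, rfl⟩ := hf.2 y
    by_contra h
    have hx : x ∉ s := fun hx => h ⟨x, hx, rfl⟩
    exact hx (hs x hx ▸ hy)

theorem exists_polynomial_eval_eq_det_one_add_smul {E : Type*} [NormedAddCommGroup E]
    [NormedSpace ℝ E] [FiniteDimensional ℝ E] (A : E →L[ℝ] E) :
    ∃ p : Polynomial ℝ, p.natDegree ≤ Module.finrank ℝ E ∧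
      ∀ t : ℝ, p.eval t = (ContinuousLinearMap.id ℝ E + t • A).det := by
  let b := Module.finBasis ℝ E
  let M := LinearMap.toMatrix b b (A : E →ₗ[ℝ] E)
  refine ⟨_, (Polynomial.natDegree_det_X_add_C_le M 1).trans (by simp), fun t => ?_⟩
  have h : (ContinuousLinearMap.id ℝ E + t • A).det
      = LinearMap.det (LinearMap.id + t • (A : E →ₗ[ℝ] E)) := rfl
  rw [h, ← LinearMap.det_toMatrix b, map_add, map_smul, LinearMap.toMatrix_id,
    ← Polynomial.coe_evalRingHom, RingHom.map_det]
  congr 1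
  ext i j
  rcases eq_or_ne i j with rfl | hij
  · simp [M, mul_comm t, add_comm (1 : ℝ)]
  · simp [M, hij, mul_comm t]

theorem exists_pos_forall_norm_lt_det_one_add_pos (E : Type*) [NormedAddCommGroup E]
    [NormedSpace ℝ E] [FiniteDimensional ℝ E] :
    ∃ δ > 0, ∀ A : E →L[ℝ] E, ‖A‖ < δ → 0 < (ContinuousLinearMap.id ℝ E + A).det := by
  have hc : Continuous fun A : E →L[ℝ] E => (ContinuousLinearMap.id ℝ E + A).det :=
    ContinuousLinearMap.continuous_det.comp (by fun_prop)
  have h0 : 0 < (ContinuousLinearMap.id ℝ E + 0).det := by simp [ContinuousLinearMap.det]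
  obtain ⟨δ, hδ, h⟩ := Metric.eventually_nhds_iff.1 (hc.continuousAt.eventually_const_lt h0)
  exact ⟨δ, hδ, fun A hA => h (by simpa using hA)⟩

section
variable {E : Type*} [NormedAddCommGroup E] [InnerProductSpace ℝ E] [FiniteDimensional ℝ E]

theorem setIntegral_det_one_add_smul_fderiv [MeasurableSpace E] [BorelSpace E] {g : E → E}
    {K : ℝ≥0} {t : ℝ}
    (hg : ∀ x ∈ closedBall (0 : E) 1, DifferentiableAt ℝ g x)
    (hK : LipschitzOnWith K g (closedBall 0 1)) (h0 : ∀ x ∈ sphere (0 : E) 1, g x = 0)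
    (ht : 0 ≤ t) (htK : t * K < 1)
    (hdet : ∀ x ∈ closedBall (0 : E) 1, 0 < (ContinuousLinearMap.id ℝ E + t • fderiv ℝ g x).det) :
    ∫ x in closedBall (0 : E) 1, (ContinuousLinearMap.id ℝ E + t • fderiv ℝ g x).det =
      volume.real (closedBall (0 : E) 1) := by
  have hbij : Function.Bijective fun x => x + t • (closedBall (0 : E) 1).indicator g x := by
    refine LipschitzWith.bijective_add (K := Real.toNNReal t * K)
      (LipschitzWith.of_dist_le_mul fun x y => ?_) (by rw [← NNReal.coe_lt_coe]; simpa [ht] using htK)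
    rw [dist_smul₀, Real.norm_of_nonneg ht, NNReal.coe_mul, Real.coe_toNNReal t ht, mul_assoc]
    exact mul_le_mul_of_nonneg_left ((hK.indicator_closedBall h0).dist_le_mul x y) ht
  have himg := hbij.image_eq_of_forall_notMem_eq (s := closedBall (0 : E) 1)
    fun x hx => by simp [indicator_of_notMem hx]
  have heq : EqOn (fun x => x + t • (closedBall (0 : E) 1).indicator g x) (fun x => x + t • g x)
      (closedBall 0 1) := fun x hx => by simp [indicator_of_mem hx]
  have hinj : InjOn (fun x => x + t • g x) (closedBall (0 : E) 1) := heq.injOn_iff.1 hbij.1.injOn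
  rw [heq.image_eq] at himg
  have := integral_image_eq_integral_abs_det_fderiv_smul volume
    (isClosed_closedBall (x := (0 : E)) (ε := 1)).measurableSet
    (fun x hx => ((hasFDerivAt_id x).add ((hg x hx).hasFDerivAt.const_smul t)).hasFDerivWithinAt)
    hinj fun _ => (1 : ℝ)
  rw [show (id + t • g) = fun x => x + t • g x from rfl, himg] at this
  rw [setIntegral_const, smul_eq_mul, mul_one] at this
  rw [this]
  refine setIntegral_congr_fun isClosed_closedBall.measurableSet fun x hx => ?_
  simp [abs_of_pos (hdet x hx)]

theorem setIntegral_det_one_add_fderiv [MeasurableSpace E] [BorelSpace E] {g : E → E}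
    (hg : ∀ x ∈ closedBall (0 : E) 1, ContDiffAt ℝ 1 g x)
    (h0 : ∀ x ∈ sphere (0 : E) 1, g x = 0) :
    ∫ x in closedBall (0 : E) 1, (ContinuousLinearMap.id ℝ E + fderiv ℝ g x).det =
      volume.real (closedBall (0 : E) 1) := by
  have hcomp := isCompact_closedBall (0 : E) 1
  have hcont : ContinuousOn (fderiv ℝ g) (closedBall 0 1) := fun x hx =>
    ((hg x hx).continuousAt_fderiv (by simp)).continuousWithinAt
  obtain ⟨C, hC⟩ := hcomp.exists_bound_of_continuousOn hcont
  have hC0 : 0 ≤ C := (norm_nonneg _).trans (hC 0 (by simp))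
  have hdiff : ∀ x ∈ closedBall (0 : E) 1, DifferentiableAt ℝ g x := fun x hx =>
    (hg x hx).differentiableAt (by simp)
  have hK : LipschitzOnWith ⟨C, hC0⟩ g (closedBall 0 1) :=
    (convex_closedBall 0 1).lipschitzOnWith_of_nnnorm_fderiv_le hdiff fun x hx => hC x hx
  obtain ⟨δ, hδ, hpos⟩ := exists_pos_forall_norm_lt_det_one_add_pos E
  obtain ⟨t₀, ht₀, ht₀'⟩ : ∃ t₀ : ℝ, 0 < t₀ ∧ t₀ * C < min 1 δ := by
    refine ⟨min 1 δ / (C + 1), by positivity, ?_⟩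
    rw [div_mul_eq_mul_div, div_lt_iff₀ (by positivity)]
    exact mul_lt_mul_of_pos_left (by linarith) (by positivity)
  have hsmall : ∀ t ∈ Icc 0 t₀,
      ∫ x in closedBall (0 : E) 1, (ContinuousLinearMap.id ℝ E + t • fderiv ℝ g x).det =
        volume.real (closedBall (0 : E) 1) := by
    intro t ht
    have htC : t * C < min 1 δ := (mul_le_mul_of_nonneg_right ht.2 hC0).trans_lt ht₀'
    refine setIntegral_det_one_add_smul_fderiv hdiff hK h0 ht.1
      (htC.trans_le (min_le_left _ _)) fun x hx => hpos _ ?_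
    rw [norm_smul, Real.norm_of_nonneg ht.1]
    exact (mul_le_mul_of_nonneg_left (hC x hx) ht.1).trans_lt (htC.trans_le (min_le_right _ _))
  have hint : ∀ t : ℝ, IntegrableOn
      (fun x => (ContinuousLinearMap.id ℝ E + t • fderiv ℝ g x).det) (closedBall 0 1) := fun t =>
    (ContinuousLinearMap.continuous_det.comp_continuousOn
      (continuousOn_const.add (hcont.const_smul t))).integrableOn_compact hcomp
  let d := Module.finrank ℝ E
  let s := Finset.range (d + 1)
  let v : ℕ → ℝ := fun i => t₀ / (i + 1)
  have hv : InjOn v s := fun i _ j _ hij => by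
    have : (i : ℝ) + 1 = j + 1 := by
      have := congrArg (fun z => t₀ / z) hij
      simpa [v, div_div_cancel₀ ht₀.ne'] using this
    exact_mod_cast add_right_cancel this
  have hvI : ∀ i, v i ∈ Icc 0 t₀ := fun i =>
    ⟨by positivity, div_le_self ht₀.le (by simp)⟩
  have hinterp : ∀ A : E →L[ℝ] E, (ContinuousLinearMap.id ℝ E + A).det =
      ∑ i ∈ s, (ContinuousLinearMap.id ℝ E + v i • A).det * (Lagrange.basis s v i).eval 1 := by
    intro A
    obtain ⟨p, hp, hpe⟩ := exists_polynomial_eval_eq_det_one_add_smul A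
    have hdeg : p.degree < s.card := by
      rw [Finset.card_range]
      exact (Polynomial.degree_le_of_natDegree_le hp).trans_lt (by exact_mod_cast Nat.lt_succ_self d)
    have h1 := congrArg (Polynomial.eval 1) (Lagrange.eq_interpolate hv hdeg)
    rw [hpe, one_smul, Lagrange.interpolate_apply, Polynomial.eval_finsetSum] at h1
    simpa [hpe] using h1
  rw [funext fun x => hinterp (fderiv ℝ g x),
    integral_finsetSum _ fun i _ => (hint (v i)).mul_const _]
  simp_rw [integral_mul_const]
  rw [Finset.sum_congr rfl fun i _ => by rw [hsmall (v i) (hvI i)], ← Finset.mul_sum,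
    ← Polynomial.eval_finsetSum, Lagrange.sum_basis hv ⟨0, by simp [s]⟩]
  simp

theorem not_exists_contDiffAt_retraction_sphere {r : E → E}
    (hr : ∀ x ∈ closedBall (0 : E) 1, ContDiffAt ℝ 1 r x)
    (hnorm : ∀ x ∈ closedBall (0 : E) 1, ‖r x‖ = 1)
    (hid : ∀ x ∈ sphere (0 : E) 1, r x = x) : False := by
  borelize E
  have h := setIntegral_det_one_add_fderiv (g := fun x => r x - x)
    (fun x hx => (hr x hx).sub contDiffAt_id) fun x hx => by simp [hid x hx]
  have hzero : ∀ x ∈ ball (0 : E) 1,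
      (ContinuousLinearMap.id ℝ E + fderiv ℝ (fun x => r x - x) x).det = 0 := by
    intro x hx
    have hxc := ball_subset_closedBall hx
    have hd := (hr x hxc).differentiableAt (by simp)
    rw [fderiv_fun_sub hd differentiableAt_fun_id, fderiv_fun_id, add_sub_cancel]
    by_contra hdet
    have horth : ∀ w, ⟪r x, fderiv ℝ r x w⟫ = 0 := by
      have hconst : (fun y => ‖r y‖ ^ 2) =ᶠ[nhds x] fun _ => 1 := by
        filter_upwards [isOpen_ball.mem_nhds hx] with y hy
        simp [hnorm y (ball_subset_closedBall hy)]
      have h1 := hd.hasFDerivAt.norm_sq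
      have h2 := h1.unique ((hasFDerivAt_const (1 : ℝ) x).congr_of_eventuallyEq hconst)
      intro w
      simpa using congrArg (fun L : E →L[ℝ] ℝ => L w) h2
    have hu : IsUnit (fderiv ℝ r x : E →ₗ[ℝ] E) := by
      rw [LinearMap.isUnit_iff_isUnit_det]
      exact isUnit_iff_ne_zero.2 hdet
    obtain ⟨w, hw⟩ := ((Module.End.isUnit_iff _).1 hu).2 (r x)
    have h3 := horth w
    rw [show fderiv ℝ r x w = r x from hw, real_inner_self_eq_norm_sq, hnorm x hxc] at h3
    norm_num at h3
  have hpos : 0 < volume.real (closedBall (0 : E) 1) :=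
    ENNReal.toReal_pos (measure_closedBall_pos _ _ one_pos).ne' measure_closedBall_lt_top.ne
  have hnt : Nontrivial E := ⟨r 0, 0, fun h => by simpa [h] using hnorm 0 (by simp)⟩
  have hsph : ∀ᵐ x, x ∉ sphere (0 : E) 1 :=
    measure_eq_zero_iff_ae_notMem.1 (Measure.addHaar_sphere volume 0 1)
  rw [setIntegral_congr_ae (g := fun _ => 0) isClosed_closedBall.measurableSet
    (hsph.mono fun x hx hxc => hzero x (lt_of_le_of_ne hxc hx))] at h
  simp only [integral_zero] at h
  exact hpos.ne h

theorem ContDiff.exists_mem_closedBall_eq {f : E → E} (hf : ContDiff ℝ 1 f)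
    (hmaps : MapsTo f (closedBall 0 1) (closedBall 0 1)) :
    ∃ x ∈ closedBall (0 : E) 1, f x = x := by
  by_contra! hne
  let u : E → E := fun x => x - f x
  let D : E → ℝ := fun x => ⟪x, u x⟫ ^ 2 + ‖u x‖ ^ 2 * (1 - ‖x‖ ^ 2)
  let s : E → ℝ := fun x => (-⟪x, u x⟫ + √(D x)) / ‖u x‖ ^ 2
  have hu : ContDiff ℝ 1 u := contDiff_id.sub hf
  have hu0 : ∀ x ∈ closedBall (0 : E) 1, 0 < ‖u x‖ ^ 2 := fun x hx =>
    pow_pos (norm_pos_iff.2 (sub_ne_zero.2 (hne x hx).symm)) 2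
  have hinner : ∀ x, ‖x‖ = 1 → 0 < ⟪x, u x⟫ := by
    intro x hx
    have hxc : x ∈ closedBall (0 : E) 1 := by simp [hx]
    have hfx : ‖f x‖ ≤ 1 := by simpa using hmaps hxc
    have h1 := hu0 x hxc
    have h2 : ‖u x‖ ^ 2 = ‖x‖ ^ 2 - 2 * ⟪x, f x⟫ + ‖f x‖ ^ 2 := norm_sub_sq_real x (f x)
    have h3 : ⟪x, u x⟫ = ‖x‖ ^ 2 - ⟪x, f x⟫ := by
      rw [inner_sub_right, real_inner_self_eq_norm_sq]
    rw [hx] at h2 h3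
    nlinarith [norm_nonneg (f x)]
  have hD : ∀ x ∈ closedBall (0 : E) 1, 0 < D x := by
    intro x hx
    have hx1 : ‖x‖ ≤ 1 := by simpa using hx
    rcases hx1.lt_or_eq with h | h
    · have : 0 < 1 - ‖x‖ ^ 2 := by nlinarith [norm_nonneg x]
      have := mul_pos (hu0 x hx) this
      positivity
    · have := hinner x h
      simp only [D, h]
      positivity
  refine not_exists_contDiffAt_retraction_sphere (r := fun x => x + s x • u x) ?_ ?_ ?_
  · intro x hx
    have hDc : ContDiffAt ℝ 1 D x :=
      (((contDiff_id.inner ℝ hu).pow 2).add ((hu.norm_sq ℝ).mul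
        (contDiff_const.sub (contDiff_id.norm_sq ℝ)))).contDiffAt
    exact contDiffAt_id.add ((((contDiff_id.inner ℝ hu).contDiffAt.neg.add
      (hDc.sqrt (hD x hx).ne')).div (hu.norm_sq ℝ).contDiffAt (hu0 x hx).ne').smul hu.contDiffAt)
  · intro x hx
    have h1 : ‖x + s x • u x‖ ^ 2 = 1 := by
      rw [norm_add_sq_real, inner_smul_right, norm_smul, mul_pow, Real.norm_eq_abs, sq_abs]
      have hs : s x * ‖u x‖ ^ 2 = -⟪x, u x⟫ + √(D x) := div_mul_cancel₀ _ (hu0 x hx).ne'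
      have hsq := Real.sq_sqrt (hD x hx).le
      have h2 : (s x * ‖u x‖ ^ 2 + ⟪x, u x⟫) ^ 2
          = ⟪x, u x⟫ ^ 2 + ‖u x‖ ^ 2 * (1 - ‖x‖ ^ 2) := by
        linear_combination (s x * ‖u x‖ ^ 2 + √(D x) + ⟪x, u x⟫) * hs + hsq
      refine mul_left_cancel₀ (hu0 x hx).ne' ?_
      linear_combination h2
    exact (pow_eq_one_iff_of_nonneg (norm_nonneg _) two_ne_zero).1 h1
  · intro x hx
    have hx1 : ‖x‖ = 1 := by simpa using hx
    have : s x = 0 := by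
      simp only [s, D, hx1]
      norm_num [Real.sqrt_sq (hinner x hx1).le]
    simp [this]

/-- **Brouwer fixed point theorem** for the closed unit ball. -/
theorem ContinuousOn.exists_mem_closedBall_eq {f : E → E}
    (hf : ContinuousOn f (closedBall 0 1))
    (hmaps : MapsTo f (closedBall 0 1) (closedBall 0 1)) :
    ∃ x ∈ closedBall (0 : E) 1, f x = x := by
  by_contra! hne
  obtain ⟨ε, hε, hεle⟩ := (isCompact_closedBall (0 : E) 1).exists_forall_le' (a := 0)
    (f := fun x => ‖f x - x‖) (hf.sub continuousOn_id).norm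
    fun x hx => norm_pos_iff.2 (sub_ne_zero.2 (hne x hx))
  obtain ⟨f', hf'⟩ := ContinuousMap.exists_restrict_eq (isClosed_closedBall (x := (0 : E)) (ε := 1))
    ⟨_, hf.domRestrict⟩
  have hff' : ∀ x ∈ closedBall (0 : E) 1, f' x = f x := fun x hx => DFunLike.congr_fun hf' ⟨x, hx⟩
  obtain ⟨g, hg, hgf, -⟩ := f'.continuous.exists_contDiff_approx 1
    (continuous_const (y := ε / 2)) fun _ => half_pos hε
  have hgf' : ∀ x ∈ closedBall (0 : E) 1, ‖g x - f x‖ < ε / 2 := fun x hx => by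
    simpa [hff' x hx, dist_eq_norm] using hgf x
  have hgn : ∀ x ∈ closedBall (0 : E) 1, ‖g x‖ ≤ 1 + ε / 2 := fun x hx => by
    have h1 : ‖f x‖ ≤ 1 := by simpa using hmaps hx
    have h2 := norm_sub_norm_le (g x) (f x)
    linarith [hgf' x hx]
  have hpos : 0 < 1 + ε / 2 := by positivity
  obtain ⟨x, hx, hfix⟩ := ContDiff.exists_mem_closedBall_eq
    (f := fun x => (1 + ε / 2)⁻¹ • g x) (contDiff_const.smul hg) fun x hx => by
      rw [mem_closedBall_zero_iff, norm_smul, Real.norm_of_nonneg (by positivity),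
        inv_mul_le_one₀ hpos]
      exact hgn x hx
  have hgx : g x = x + (ε / 2) • x := by
    rw [inv_smul_eq_iff₀ hpos.ne'] at hfix
    rw [hfix, add_smul, one_smul]
  have h1 : ‖f x - x‖ ≤ ‖g x - f x‖ + ‖(ε / 2) • x‖ := by
    rw [show f x - x = (ε / 2) • x - (g x - f x) by rw [hgx]; abel, add_comm]
    exact norm_sub_le _ _
  have h2 : ‖(ε / 2) • x‖ ≤ ε / 2 := by
    rw [norm_smul, Real.norm_of_nonneg (by positivity)]
    exact mul_le_of_le_one_right (by positivity) (by simpa using hx)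
  linarith [hεle x hx, hgf' x hx]

theorem ContinuousOn.exists_mem_closedBall_eq_zero {h : E → E}
    (hc : ContinuousOn h (closedBall 0 1)) (hle : ∀ x ∈ closedBall (0 : E) 1, ‖h x - x‖ ≤ 1) :
    ∃ x ∈ closedBall (0 : E) 1, h x = 0 := by
  obtain ⟨x, hx, hfix⟩ := ContinuousOn.exists_mem_closedBall_eq
    (f := fun x => x - h x) (continuousOn_id.sub hc) fun x hx => by
      simpa [norm_sub_rev] using hle x hx
  exact ⟨x, hx, by simpa using hfix⟩

theorem mem_interior_image_closedBall_of_injOn {F : E → E}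
    (hF : ContinuousOn F (closedBall 0 1)) (hinj : InjOn F (closedBall 0 1)) :
    F 0 ∈ interior (F '' closedBall 0 1) := by
  borelize E
  by_contra hint
  have hBc : IsCompact (closedBall (0 : E) 1) := isCompact_closedBall 0 1
  have : CompactSpace (closedBall (0 : E) 1) := isCompact_iff_compactSpace.1 hBc
  have hK : IsCompact (F '' closedBall 0 1) := hBc.image_of_continuousOn hF
  obtain ⟨G, hG⟩ := ContinuousMap.exists_extension
    (hF.domRestrict.isClosedEmbedding (injOn_iff_injective.1 hinj))
    (⟨Subtype.val, continuous_subtype_val⟩ : C(closedBall (0 : E) 1, E))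
  have hGF : ∀ x ∈ closedBall (0 : E) 1, G (F x) = x := fun x hx => DFunLike.congr_fun hG ⟨x, hx⟩
  have h0 : (0 : E) ∈ closedBall 0 1 := by simp
  obtain ⟨η, hη, hGη⟩ := Metric.continuousAt_iff.1 (G.continuous.continuousAt (x := F 0))
    (1 / 10) (by norm_num)
  rw [hGF 0 h0] at hGη
  simp only [dist_zero_right] at hGη
  obtain ⟨ε, hε, hεη⟩ : ∃ ε > 0, 2 * ε < η := ⟨η / 3, by positivity, by linarith⟩
  obtain ⟨c, hcε, hcK⟩ : ∃ c, dist c (F 0) < ε ∧ c ∉ F '' closedBall 0 1 := by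
    by_contra! hall
    exact hint (mem_interior_iff_mem_nhds.2 (Metric.mem_nhds_iff.2 ⟨ε, hε, hall⟩))
  -- `G` is bounded away from zero on the part of the image far from `c`.
  obtain ⟨δ₀, hδ₀, hδ₀le⟩ :=
    (hK.inter_right (isClosed_le continuous_const (continuous_id.dist continuous_const) :
      IsClosed {y | ε ≤ dist y c})).exists_forall_le' (a := 0) (f := fun y => ‖G y‖)
      G.continuous.norm.continuousOn (by
        rintro _ ⟨⟨x, hx, rfl⟩, hxc⟩
        rw [hGF x hx, norm_pos_iff]
        rintro rfl
        exact absurd hxc (by simpa [dist_comm] using hcε))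
  obtain ⟨δ, hδ, hδδ₀, hδ'⟩ : ∃ δ > 0, δ ≤ δ₀ ∧ δ ≤ 1 / 10 :=
    ⟨min δ₀ (1 / 10), by positivity, min_le_left _ _, min_le_right _ _⟩
  obtain ⟨P, hP, hPG, -⟩ := G.continuous.exists_contDiff_approx 1
    (continuous_const (y := δ / 2)) fun _ => half_pos hδ
  have hnull : volume (P '' sphere c ε) = 0 :=
    addHaar_image_eq_zero_of_differentiableOn_of_addHaar_eq_zero volume
      (hP.differentiable (by simp)).differentiableOn
      (Measure.addHaar_sphere_of_ne_zero volume c hε.ne')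
  obtain ⟨v, hv, hvP⟩ : ∃ v ∈ ball (0 : E) (δ / 2), v ∉ P '' sphere c ε := by
    by_contra! hall
    exact (measure_ball_pos volume (0 : E) (half_pos hδ)).ne' (measure_mono_null hall hnull)
  have hQ : ∀ y, ‖P y - v - G y‖ < δ := fun y => by
    have h1 : ‖P y - G y‖ < δ / 2 := by simpa [dist_eq_norm] using hPG y
    have h2 : ‖v‖ < δ / 2 := by simpa using hv
    rw [sub_right_comm]
    linarith [norm_sub_le (P y - G y) v]
  -- `Φ` pushes the ball of radius `ε` around `c` radially onto its boundary sphere.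
  let Φ : E → E := fun y => c + max (ε / ‖y - c‖) 1 • (y - c)
  have hΦfar : ∀ y, ε ≤ ‖y - c‖ → Φ y = y := fun y hy => by
    simp [Φ, max_eq_right (div_le_one_of_le₀ hy (norm_nonneg _))]
  have hΦnear : ∀ y, y ≠ c → ‖y - c‖ ≤ ε → Φ y ∈ sphere c ε := fun y hy hyε => by
    have hpos : 0 < ‖y - c‖ := norm_pos_iff.2 (sub_ne_zero.2 hy)
    rw [mem_sphere_iff_norm, add_sub_cancel_left, max_eq_left ((one_le_div hpos).2 hyε), norm_smul,
      Real.norm_of_nonneg (by positivity), div_mul_cancel₀ _ hpos.ne']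
  have hFc : ∀ x ∈ closedBall (0 : E) 1, F x ≠ c := fun x hx h => hcK ⟨x, hx, h⟩
  have hΦF : ContinuousOn (fun x => Φ (F x)) (closedBall 0 1) := by
    have hsub : ContinuousOn (fun x => F x - c) (closedBall 0 1) := hF.sub continuousOn_const
    exact continuousOn_const.add (((continuousOn_const.div hsub.norm fun x hx =>
      (norm_pos_iff.2 (sub_ne_zero.2 (hFc x hx))).ne').sup continuousOn_const).smul hsub)
  obtain ⟨x, hx, hx0⟩ := ContinuousOn.exists_mem_closedBall_eq_zero
    (h := fun x => P (Φ (F x)) - v)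
    ((hP.continuous.comp_continuousOn hΦF).sub continuousOn_const) fun x hx => by
      rcases le_total ε ‖F x - c‖ with h | h
      · have := hQ (F x)
        rw [hGF x hx] at this
        simp only [hΦfar _ h]
        linarith
      · have hs := hΦnear _ (hFc x hx) h
        have h1 : ‖G (Φ (F x))‖ < 1 / 10 := hGη (by
          have := dist_triangle (Φ (F x)) c (F 0)
          rw [mem_sphere.1 hs] at this
          linarith)
        have h2 : ‖x‖ < 1 / 10 := by
          have h3 : ‖G (F x)‖ < 1 / 10 := hGη (by
            have := dist_triangle (F x) c (F 0)
            rw [dist_eq_norm (F x) c] at this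
            linarith)
          rwa [hGF x hx] at h3
        have h3 := hQ (Φ (F x))
        have h4 : ‖P (Φ (F x)) - v - x‖ ≤
            ‖P (Φ (F x)) - v - G (Φ (F x))‖ + ‖G (Φ (F x))‖ + ‖x‖ := by
          rw [show P (Φ (F x)) - v - x =
            P (Φ (F x)) - v - G (Φ (F x)) + G (Φ (F x)) - x by abel]
          exact (norm_sub_le _ _).trans (by gcongr; exact norm_add_le _ _)
        linarith
  rcases le_total ε ‖F x - c‖ with h | h
  · simp only [hΦfar _ h] at hx0
    have h1 := hQ (F x)
    rw [hx0, zero_sub, norm_neg] at h1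
    have := hδ₀le (F x) ⟨⟨x, hx, rfl⟩, by simpa [dist_eq_norm] using h⟩
    linarith
  · exact hvP ⟨_, hΦnear _ (hFc x hx) h, sub_eq_zero.1 hx0⟩

/-- **Invariance of domain**. -/
theorem IsOpen.image_of_continuousOn_of_injOn {F : E → E} {U : Set E} (hU : IsOpen U)
    (hF : ContinuousOn F U) (hinj : InjOn F U) : IsOpen (F '' U) := by
  rw [isOpen_iff_mem_nhds]
  rintro _ ⟨x, hx, rfl⟩
  obtain ⟨ρ, hρ, hρU⟩ := Metric.nhds_basis_closedBall.mem_iff.1 (hU.mem_nhds hx)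
  have hmaps : MapsTo (fun z => x + ρ • z) (closedBall 0 1) U := fun z hz => hρU (by
    have hz1 : ‖z‖ ≤ 1 := by simpa using hz
    simpa [norm_smul, abs_of_pos hρ] using mul_le_of_le_one_right hρ.le hz1)
  have h := mem_interior_image_closedBall_of_injOn (F := fun z => F (x + ρ • z))
    (hF.comp (by fun_prop) hmaps)
    (hinj.comp (fun a _ b _ hab => smul_right_injective E hρ.ne' (add_left_cancel hab)) hmaps)
  simp only [smul_zero, add_zero] at h
  refine Filter.mem_of_superset (mem_interior_iff_mem_nhds.1 h) ?_
  rintro _ ⟨z, hz, rfl⟩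
  exact ⟨_, hmaps hz, rfl⟩

theorem ball_subset_image_of_forall_frontier_le_norm {F : E → E} {X : Set E} {r : ℝ}
    (hX : IsCompact X) (hF : ContinuousOn F X) (hinj : InjOn F X) (h0 : 0 ∈ F '' X)
    (hr : ∀ x ∈ frontier X, r ≤ ‖F x‖) : ball 0 r ⊆ F '' X := by
  rcases le_or_gt r 0 with hr0 | hr0
  · simp [ball_eq_empty.2 hr0]
  have hcover : ∀ y ∈ ball (0 : E) r, y ∈ F '' X → y ∈ F '' interior X := by
    rintro _ hy ⟨x, hx, rfl⟩
    refine ⟨x, by_contra fun hxi => ?_, rfl⟩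
    exact (hr x ⟨subset_closure hx, hxi⟩).not_gt (by simpa using hy)
  have hopen : IsOpen (F '' interior X) := isOpen_interior.image_of_continuousOn_of_injOn
    (hF.mono interior_subset) (hinj.mono interior_subset)
  have hsub : F '' interior X ⊆ F '' X := image_mono interior_subset
  refine ((convex_ball (0 : E) r).isPreconnected.subset_left_of_subset_union hopen
    (hX.image_of_continuousOn hF).isClosed.isOpen_compl
    (disjoint_compl_right.mono_left hsub) (fun y hy => ?_)
    ⟨0, mem_ball_self hr0, hcover 0 (mem_ball_self hr0) h0⟩).trans hsub
  exact (em (y ∈ F '' X)).imp (hcover y hy) id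

end

end InvarianceOfDomain

theorem sSup_inner_unit_eq_norm {E : Type*} [NormedAddCommGroup E] [InnerProductSpace ℝ E]
    [Nontrivial E] (y : E) :
    sSup ((fun l => ⟪l, y⟫) '' {l : E | ‖l‖ = 1}) = ‖y‖ := by
  refine IsGreatest.csSup_eq ⟨?_, ?_⟩
  · rcases eq_or_ne y 0 with rfl | hy
    · obtain ⟨l, hl⟩ := exists_norm_eq E zero_le_one
      exact ⟨l, hl, by simp⟩
    · have hy' : ‖y‖ ≠ 0 := norm_ne_zero_iff.2 hy
      refine ⟨‖y‖⁻¹ • y, by simp [norm_smul, hy'], ?_⟩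
      simp only [inner_smul_left, real_inner_self_eq_norm_sq]
      simp [sq, hy']
  · rintro _ ⟨l, hl, rfl⟩
    simpa [show ‖l‖ = 1 from hl] using real_inner_le_norm l y

/-- For a nonempty compact `X ⊆ ℝⁿ` with nonempty frontier and a continuous `F`
injective on `X` with `0 ∈ F(X)`,
`inf_{‖λ‖=1} sup_{x∈X} λᵀF(x) ≥ inf_{x∈∂X} sup_{‖λ‖=1} λᵀF(x)`. -/
theorem stmt_1 {n : ℕ} (hn : 1 ≤ n) (X : Set (EuclideanSpace ℝ (Fin n)))
    (hXne : X.Nonempty) (hXc : IsCompact X) (hfr : (frontier X).Nonempty)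
    (F : EuclideanSpace ℝ (Fin n) → EuclideanSpace ℝ (Fin n)) (hF : Continuous F)
    (hinj : Set.InjOn F X)
    (h0 : (0 : EuclideanSpace ℝ (Fin n)) ∈ F '' X) :
    sInf ((fun x => sSup ((fun l => ⟪l, F x⟫) ''
        {l : EuclideanSpace ℝ (Fin n) | ‖l‖ = 1})) '' frontier X) ≤
      sInf ((fun l => sSup ((fun x => ⟪l, F x⟫) '' X)) ''
        {l : EuclideanSpace ℝ (Fin n) | ‖l‖ = 1}) := by
  have : NeZero n := ⟨by omega⟩
  simp_rw [sSup_inner_unit_eq_norm]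
  obtain ⟨l₀, hl₀⟩ := exists_norm_eq (EuclideanSpace ℝ (Fin n)) zero_le_one
  refine le_csInf ⟨_, l₀, hl₀, rfl⟩ ?_
  rintro _ ⟨l, hl, rfl⟩
  have hl1 : ‖l‖ = 1 := hl
  have hball := ball_subset_image_of_forall_frontier_le_norm hXc hF.continuousOn hinj h0
    fun x hx => csInf_le (s := (fun x => ‖F x‖) '' frontier X)
      ⟨0, by rintro _ ⟨y, -, rfl⟩; exact norm_nonneg _⟩ ⟨x, hx, rfl⟩
  have hbdd : BddAbove ((fun x => ⟪l, F x⟫) '' X) :=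
    (hXc.image (continuous_const.inner hF)).bddAbove
  have hle : ∀ y ∈ F '' X, ⟪l, y⟫ ≤ sSup ((fun x => ⟪l, F x⟫) '' X) := by
    rintro _ ⟨x, hx, rfl⟩
    exact le_csSup hbdd ⟨x, hx, rfl⟩
  refine le_of_forall_lt_imp_le_of_dense fun s hs => ?_
  rcases le_or_gt s 0 with hs0 | hs0
  · exact hs0.trans (by simpa using hle 0 h0)
  · have := hle (s • l) (hball (by simpa [norm_smul, hl1, abs_of_pos hs0] using hs))
    simpa [inner_smul_right, hl1] using this
end

section
/- Let X be a compact subset of ℝⁿ and let F : ℝⁿ → ℝⁿ be continuous and injective on X. Then the frontier of the image equals the image of the frontier: ∂(F(X)) = F(∂X), where ∂ denotes the topological frontier (boundary). -/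
open Set Metric MeasureTheory Filter Topology
open scoped NNReal

/-- The radial map pushing every nonzero vector of norm less than `R` onto the sphere of
radius `R` is Lipschitz away from the origin. -/
theorem exists_lipschitzOnWith_radial_push {E : Type*} [NormedAddCommGroup E] [NormedSpace ℝ E]
    {m R : ℝ} (hm : 0 < m) (hR : 0 ≤ R) :
    ∃ C : ℝ≥0, LipschitzOnWith C
      (fun y : E => y + (max 0 (R - ‖y‖) * ‖y‖⁻¹) • y) {y | m ≤ ‖y‖} := by
  refine ⟨(1 + (R * (2 * m⁻¹) + 1)).toNNReal, LipschitzOnWith.of_dist_le_mul fun x hx y hy => ?_⟩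
  simp only [mem_ofPred_eq] at hx hy
  rw [Real.coe_toNNReal _ (by positivity), dist_eq_norm, dist_eq_norm]
  have hx0 : 0 < ‖x‖ := hm.trans_le hx
  have hy0 : 0 < ‖y‖ := hm.trans_le hy
  have hdir : ‖‖x‖⁻¹ • x - ‖y‖⁻¹ • y‖ ≤ 2 * m⁻¹ * ‖x - y‖ := by
    have e : ‖x‖⁻¹ • x - ‖y‖⁻¹ • y = ‖x‖⁻¹ • (x - y) + (‖x‖⁻¹ * (‖y‖ - ‖x‖)) • ‖y‖⁻¹ • y := by
      rw [smul_sub, smul_smul, mul_sub, inv_mul_cancel₀ hx0.ne', sub_mul, mul_assoc,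
        mul_inv_cancel₀ hy0.ne', sub_smul]
      simp
    have hu : ‖‖y‖⁻¹ • y‖ = 1 := by
      rw [norm_smul, norm_inv, norm_norm, inv_mul_cancel₀ hy0.ne']
    have hi : ‖x‖⁻¹ ≤ m⁻¹ := inv_anti₀ hm hx
    calc _ ≤ ‖x‖⁻¹ * ‖x - y‖ + ‖x‖⁻¹ * ‖x - y‖ := by
          rw [e]
          refine (norm_add_le _ _).trans ?_
          rw [norm_smul, norm_smul _ (‖y‖⁻¹ • y), hu, mul_one, norm_mul, norm_inv, norm_norm]
          gcongr
          rw [norm_sub_rev x y]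
          exact abs_norm_sub_norm_le y x
      _ ≤ m⁻¹ * ‖x - y‖ + m⁻¹ * ‖x - y‖ := by gcongr
      _ = _ := by ring
  set a := max 0 (R - ‖x‖)
  set b := max 0 (R - ‖y‖)
  have ha : |a| ≤ R := by
    rw [abs_of_nonneg (le_max_left _ _)]
    exact max_le hR (by linarith)
  have hab : |a - b| ≤ ‖x - y‖ := by
    refine (abs_max_sub_max_le_max 0 (R - ‖x‖) 0 (R - ‖y‖)).trans ?_
    refine max_le (by simp) ?_
    rw [sub_sub_sub_cancel_left, norm_sub_rev]
    exact abs_norm_sub_norm_le y x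
  have hu : ‖‖y‖⁻¹ • y‖ = 1 := by
    rw [norm_smul, norm_inv, norm_norm, inv_mul_cancel₀ hy0.ne']
  have e : x + (a * ‖x‖⁻¹) • x - (y + (b * ‖y‖⁻¹) • y) =
      (x - y) + (a • (‖x‖⁻¹ • x - ‖y‖⁻¹ • y) + (a - b) • ‖y‖⁻¹ • y) := by
    module
  rw [e]
  calc _ ≤ ‖x - y‖ + (|a| * ‖‖x‖⁻¹ • x - ‖y‖⁻¹ • y‖ + |a - b|) := by
        refine (norm_add_le _ _).trans (add_le_add_right ((norm_add_le _ _).trans ?_) _)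
        rw [norm_smul, norm_smul _ (‖y‖⁻¹ • y), hu, mul_one, Real.norm_eq_abs, Real.norm_eq_abs]
    _ ≤ ‖x - y‖ + (R * (2 * m⁻¹ * ‖x - y‖) + ‖x - y‖) := by gcongr
    _ = _ := by ring

section NoRetraction

variable {E : Type*} [NormedAddCommGroup E] [InnerProductSpace ℝ E] [FiniteDimensional ℝ E]

/-- A value `det (1 + A)` is a fixed affine combination of the values `det (1 + t • A)`
for finitely many small parameters `t > 0`. -/
theorem exists_det_one_add_eq_sum (ε : ℝ) (hε : 0 < ε) :
    ∃ (t c : ℕ → ℝ) (N : ℕ), (∀ i, 0 < t i ∧ t i ≤ ε) ∧ ∑ i ∈ Finset.range N, c i = 1 ∧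
      ∀ A : E →L[ℝ] E, (1 + A).det = ∑ i ∈ Finset.range N, c i * (1 + t i • A).det := by
  let t : ℕ → ℝ := fun i => ε / (i + 1)
  have ht : Function.Injective t := by
    intro i j hij
    simp only [t] at hij
    field_simp at hij
    exact_mod_cast (add_right_cancel hij).symm
  let N := Module.finrank ℝ E + 1
  let c : ℕ → ℝ := fun i => (Lagrange.basis (Finset.range N) t i).eval 1
  have key : ∀ p : Polynomial ℝ, p.natDegree ≤ Module.finrank ℝ E →
      p.eval 1 = ∑ i ∈ Finset.range N, c i * p.eval (t i) := by
    intro p hp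
    have h := Lagrange.eq_interpolate (s := Finset.range N) (v := t) (f := p) ht.injOn (by
      refine lt_of_le_of_lt Polynomial.degree_le_natDegree ?_
      rw [Finset.card_range]
      exact_mod_cast Nat.lt_succ_of_le hp)
    conv_lhs => rw [h]
    simp [Lagrange.interpolate_apply, Polynomial.eval_finsetSum, c, mul_comm]
  refine ⟨t, c, N, fun i => ⟨by positivity, div_le_self hε.le (by linarith [i.cast_nonneg (α := ℝ)])⟩,
    by simpa using (key 1 (by simp)).symm, fun A => ?_⟩
  let b := Module.finBasis ℝ E
  let M := LinearMap.toMatrix b b (A : E →ₗ[ℝ] E)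
  have hev : ∀ s : ℝ, (1 + s • A).det = (Matrix.det
      ((Polynomial.X : Polynomial ℝ) • M.map Polynomial.C
        + (1 : Matrix _ _ ℝ).map Polynomial.C)).eval s := by
    intro s
    rw [ContinuousLinearMap.det, ← LinearMap.det_toMatrix b, ← Polynomial.coe_evalRingHom,
      RingHom.map_det]
    congr 1
    ext i j
    by_cases h : i = j <;>
      simp [M, LinearMap.toMatrix_apply, h, add_comm, mul_comm s]
  have := key _ ((Polynomial.natDegree_det_X_add_C_le M 1).trans (by simp))
  rw [← hev] at this
  simp only [← hev] at this
  simpa using this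

theorem det_one_add_pos_of_norm_lt_one (A : E →L[ℝ] E) (hA : ‖A‖ < 1) : 0 < (1 + A).det := by
  have hne : ∀ s ∈ Icc (0 : ℝ) 1, (1 + s • A).det ≠ 0 := by
    intro s hs h
    obtain ⟨x, hx, hx0⟩ : ∃ x, (1 + s • A) x = 0 ∧ x ≠ 0 := by
      have := LinearMap.bot_lt_ker_of_det_eq_zero h
      obtain ⟨x, hx, hx0⟩ := Submodule.exists_mem_ne_zero_of_ne_bot this.ne'
      exact ⟨x, hx, hx0⟩
    have h1 : x = -(s • A x) := by
      simpa [add_eq_zero_iff_eq_neg] using hx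
    have h2 : ‖x‖ ≤ ‖A‖ * ‖x‖ := by
      calc ‖x‖ = s * ‖A x‖ := by
            conv_lhs => rw [h1]
            rw [norm_neg, norm_smul, Real.norm_of_nonneg hs.1]
        _ ≤ 1 * ‖A x‖ := by gcongr; exact hs.2
        _ ≤ _ := by simpa using A.le_opNorm x
    nlinarith [norm_pos_iff.2 hx0]
  by_contra! hneg
  have hcont : ContinuousOn (fun s : ℝ => (1 + s • A).det) (Icc 0 1) :=
    (ContinuousLinearMap.continuous_det.comp (by fun_prop)).continuousOn
  obtain ⟨s, hs, h0⟩ := intermediate_value_Icc' zero_le_one hcont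
    (show (0 : ℝ) ∈ Icc _ _ from ⟨by simpa using hneg, by simp [ContinuousLinearMap.det]⟩)
  exact hne s hs h0

/-- A Lipschitz self-map of a Euclidean space which is the identity outside a ball cannot map
that ball into its bounding sphere, if it is differentiable inside the ball. -/
theorem not_lipschitz_retraction_sphere {K : ℝ≥0} {R : ℝ} (hR : 0 < R) {r : E → E}
    (hlip : LipschitzWith K r) (hd : DifferentiableOn ℝ r (ball 0 R))
    (hid : ∀ x, R ≤ ‖x‖ → r x = x) (hsph : ∀ x, ‖x‖ < R → ‖r x‖ = R) : False := by
  borelize E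
  let ψ : E → E := fun x => r x - x
  have hψ : LipschitzWith (K + 1) ψ := hlip.sub LipschitzWith.id
  let D : E → E →L[ℝ] E := fun x => fderiv ℝ ψ x
  have hda : ∀ x ∈ ball (0 : E) R, DifferentiableAt ℝ r x := fun x hx =>
    hd.differentiableAt (isOpen_ball.mem_nhds hx)
  have hD : ∀ x ∈ ball (0 : E) R, HasFDerivAt ψ (D x) x := fun x hx =>
    ((hda x hx).sub differentiableAt_id).hasFDerivAt
  have hDn : ∀ x ∈ ball (0 : E) R, ‖D x‖ ≤ K + 1 := fun x hx =>
    (hD x hx).le_of_lipschitz hψ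
  let ε : ℝ := 1 / (K + 2)
  have hε : 0 < ε := by positivity
  have hεK : ε * (K + 1) < 1 := by
    simp only [ε]; rw [one_div, inv_mul_lt_iff₀ (by positivity)]; linarith
  obtain ⟨t, c, N, ht, hc, hdet⟩ := exists_det_one_add_eq_sum (E := E) ε hε
  have hvol : ∀ i, IntegrableOn (fun x => (1 + t i • D x).det) (ball 0 R) ∧
      ∫ x in ball (0 : E) R, (1 + t i • D x).det = volume.real (ball (0 : E) R) := by
    intro i
    let f : E → E := fun x => x + t i • ψ x
    have hK : t i * (K + 1) < 1 :=
      lt_of_le_of_lt (mul_le_mul_of_nonneg_right (ht i).2 (by positivity)) hεK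
    let τ : ℝ≥0 := (t i).toNNReal
    have hτ : (τ : ℝ) = t i := Real.coe_toNNReal _ (ht i).1.le
    have happ : ApproximatesLinearOn f ((ContinuousLinearEquiv.refl ℝ E : E ≃L[ℝ] E) : E →L[ℝ] E)
        univ (τ * (K + 1)) := by
      intro x _ y _
      have : f x - f y - (x - y) = t i • (ψ x - ψ y) := by simp only [f, smul_sub]; abel
      simp only [ContinuousLinearEquiv.coe_refl, ContinuousLinearMap.coe_id', id, this]
      rw [norm_smul, Real.norm_of_nonneg (ht i).1.le]
      have := mul_le_mul_of_nonneg_left (hψ.norm_sub_le x y) (ht i).1.le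
      simpa [mul_assoc, hτ] using this
    have hsmall : Subsingleton E ∨ τ * (K + 1) <
        ‖((ContinuousLinearEquiv.refl ℝ E).symm : E →L[ℝ] E)‖₊⁻¹ := by
      rcases subsingleton_or_nontrivial E with h | h
      · exact Or.inl h
      · right
        have : ‖((ContinuousLinearEquiv.refl ℝ E).symm : E →L[ℝ] E)‖₊ = 1 := by
          simp
        rw [this, inv_one, ← NNReal.coe_lt_coe]
        simpa [hτ] using hK
    have hinj : Function.Injective f := injOn_univ.1 (happ.injOn hsmall)
    have hsurj : Function.Surjective f := happ.surjective hsmall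
    have hfid : ∀ x, R ≤ ‖x‖ → f x = x := fun x hx => by simp [f, ψ, hid x hx]
    have himg : f '' ball 0 R = ball 0 R := by
      ext y
      simp only [mem_image, mem_ball_zero_iff]
      constructor
      · rintro ⟨x, hx, rfl⟩
        by_contra! h
        have := hinj (hfid _ h)
        rw [this] at h
        exact absurd hx h.not_gt
      · intro hy
        obtain ⟨x, rfl⟩ := hsurj y
        refine ⟨x, ?_, rfl⟩
        by_contra! h
        rw [hfid x h] at hy
        exact absurd hy h.not_gt
    have hf' : ∀ x ∈ ball (0 : E) R, HasFDerivWithinAt f (1 + t i • D x) (ball 0 R) x :=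
      fun x hx => ((hasFDerivAt_id x).add ((hD x hx).const_smul (t i))).hasFDerivWithinAt
    have hpos : ∀ x ∈ ball (0 : E) R, |(1 + t i • D x).det| = (1 + t i • D x).det := by
      intro x hx
      refine abs_of_pos (det_one_add_pos_of_norm_lt_one _ ?_)
      rw [norm_smul, Real.norm_of_nonneg (ht i).1.le]
      exact lt_of_le_of_lt (mul_le_mul_of_nonneg_left (hDn x hx) (ht i).1.le) hK
    constructor
    · have := (integrableOn_image_iff_integrableOn_abs_det_fderiv_smul volume measurableSet_ball
        hf' hinj.injOn (fun _ => (1 : ℝ))).1 (by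
          rw [himg]; exact integrableOn_const measure_ball_lt_top.ne)
      refine this.congr_fun (fun x hx => ?_) measurableSet_ball
      simp [hpos x hx]
    · have := integral_image_eq_integral_abs_det_fderiv_smul volume measurableSet_ball
        hf' hinj.injOn (fun _ => (1 : ℝ))
      rw [himg] at this
      rw [← setIntegral_congr_fun measurableSet_ball hpos]
      simpa using this.symm
  have hzero : ∀ x ∈ ball (0 : E) R, (1 + D x).det = 0 := by
    intro x hx
    have hr : HasFDerivAt r (1 + D x) x := by
      have := (hasFDerivAt_id x).add (hD x hx)
      refine this.congr_of_eventuallyEq (Eventually.of_forall fun y => ?_)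
      simp [ψ]
    by_contra hne
    have hsurj : Function.Surjective (1 + D x : E →L[ℝ] E) :=
      (LinearMap.equivOfDetNeZero ((1 + D x : E →L[ℝ] E) : E →ₗ[ℝ] E) hne).surjective
    obtain ⟨v, hv⟩ := hsurj (r x)
    have h1 : HasFDerivAt (fun y => ‖r y‖ ^ 2) _ x := hr.norm_sq
    have h2 : HasFDerivAt (fun y => ‖r y‖ ^ 2) (0 : E →L[ℝ] ℝ) x := by
      refine (hasFDerivAt_const (R ^ 2) x).congr_of_eventuallyEq ?_
      filter_upwards [isOpen_ball.mem_nhds hx] with y hy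
      rw [hsph y (by simpa using hy)]
    have h3 := congrArg (fun L => L v) (h1.unique h2)
    have h4 : ‖r x‖ = R := hsph x (by simpa using hx)
    simp only [smul_apply, ContinuousLinearMap.comp_apply, hv] at h3
    simp [h4] at h3
    exact hR.ne' h3
  have h0 : ∫ x in ball (0 : E) R, (1 + D x).det = 0 := by
    rw [setIntegral_congr_fun measurableSet_ball hzero]; simp
  have h1 : ∫ x in ball (0 : E) R, (1 + D x).det = volume.real (ball (0 : E) R) := by
    rw [setIntegral_congr_fun measurableSet_ball fun x _ => hdet (D x)]
    rw [integral_finsetSum _ fun i _ => (hvol i).1.const_mul _]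
    simp_rw [integral_const_mul, (hvol _).2, ← Finset.sum_mul, hc, one_mul]
  have h2 : 0 < volume.real (ball (0 : E) R) :=
    ENNReal.toReal_pos (measure_ball_pos _ _ hR).ne' measure_ball_lt_top.ne
  linarith

/-- A continuous map on the closed unit ball which is uniformly close to the identity has
a zero. -/
theorem exists_zero_of_norm_sub_id_le {H : E → E} (hH : ContinuousOn H (closedBall 0 1))
    (hclose : ∀ x ∈ closedBall (0 : E) 1, ‖H x - x‖ ≤ 1 / 2) :
    ∃ x ∈ closedBall (0 : E) 1, H x = 0 := by
  by_contra! hne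
  obtain ⟨δ, hδ, hHδ⟩ := (isCompact_closedBall (0 : E) 1).exists_forall_le' hH.norm
    (fun x hx => norm_pos_iff.2 (hne x hx))
  have : TietzeExtension E := TietzeExtension.of_tvs ℝ
  obtain ⟨H', hH'⟩ := ContinuousMap.exists_restrict_eq isClosed_closedBall
    ⟨(closedBall (0 : E) 1).domRestrict H, hH.domRestrict⟩
  have hHeq : ∀ x ∈ closedBall (0 : E) 1, H' x = H x := fun x hx =>
    congrArg (fun k : C(closedBall (0 : E) 1, E) => k ⟨x, hx⟩) hH'
  have hδ' : 0 < min (δ / 2) (1 / 4) := by positivity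
  obtain ⟨g, hg, hgH, -⟩ := H'.continuous.exists_contDiff_approx 1
    (ε := fun _ => min (δ / 2) (1 / 4)) continuous_const (fun _ => hδ')
  have hgH1 : ∀ x ∈ closedBall (0 : E) 1, ‖g x - H x‖ < min (δ / 2) (1 / 4) := fun x hx => by
    rw [← hHeq x hx, ← dist_eq_norm]
    exact hgH x
  have hgδ : ∀ x ∈ closedBall (0 : E) 1, δ / 2 ≤ ‖g x‖ := fun x hx => by
    have h1 := (hgH1 x hx).trans_le (min_le_left _ _)
    have h2 := norm_sub_norm_le (H x) (g x)
    rw [norm_sub_rev] at h2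
    linarith [hHδ x hx]
  have hgid : ∀ x ∈ closedBall (0 : E) 1, ‖g x - x‖ ≤ 3 / 4 := fun x hx => by
    have h1 := (hgH1 x hx).trans_le (min_le_right _ _)
    have h2 := norm_add_le (g x - H x) (H x - x)
    rw [sub_add_sub_cancel] at h2
    linarith [hclose x hx]
  let χ : ContDiffBump (0 : E) := ⟨4 / 5, 1, by norm_num, by norm_num⟩
  let φ : E → E := fun x => χ x • (g x - x)
  have hφd : ContDiff ℝ 1 φ := χ.contDiff.smul (hg.sub contDiff_id)
  have hφ0 : ∀ x, 1 ≤ ‖x‖ → φ x = 0 := fun x hx => by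
    simp [φ, χ.zero_of_le_dist (x := x) (by simpa using hx)]
  have hφ1 : ∀ x, ‖φ x‖ ≤ 3 / 4 := fun x => by
    rcases le_total 1 ‖x‖ with hx | hx
    · rw [hφ0 x hx]; norm_num
    · rw [norm_smul, Real.norm_of_nonneg χ.nonneg]
      have := hgid x (by simpa using hx)
      nlinarith [χ.le_one (x := x), χ.nonneg (x := x), norm_nonneg (g x - x)]
  obtain ⟨C, hC⟩ := ContDiff.lipschitzWith_of_hasCompactSupport (𝕂 := ℝ)
    (χ.hasCompactSupport.smul_right : HasCompactSupport φ) hφd one_ne_zero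
  let h : E → E := fun x => x + φ x
  have hlip : LipschitzWith (1 + C) h := LipschitzWith.id.add hC
  let m := min (δ / 2) (1 / 20)
  have hm : 0 < m := by positivity
  have hhm : ∀ x, m ≤ ‖h x‖ := fun x => by
    rcases le_total ‖x‖ (4 / 5) with hx | hx
    · have : h x = g x := by
        simp [h, φ, χ.one_of_mem_closedBall (x := x) (by simpa using hx)]
      rw [this]
      exact (min_le_left _ _).trans (hgδ x (by simpa using hx.trans (by norm_num)))
    · refine (min_le_right _ _).trans ?_
      have := norm_sub_le (h x) (φ x)
      simp only [h, add_sub_cancel_right] at this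
      linarith [hφ1 x]
  have hh2 : ∀ x, ‖x‖ < 2 → ‖h x‖ ≤ 2 := fun x hx => by
    rcases le_total 1 ‖x‖ with h1 | h1
    · simpa [h, hφ0 x h1] using hx.le
    · linarith [norm_add_le x (φ x), hφ1 x]
  obtain ⟨C', hC'⟩ := exists_lipschitzOnWith_radial_push (E := E) (R := 2) hm (by norm_num)
  let r : E → E := fun x => h x + (max 0 (2 - ‖h x‖) * ‖h x‖⁻¹) • h x
  have hr : ∀ x, ‖x‖ < 2 → r x = (2 * ‖h x‖⁻¹) • h x := fun x hx => by
    have hpos : 0 < ‖h x‖ := hm.trans_le (hhm x)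
    simp only [r]
    rw [max_eq_right (by linarith [hh2 x hx]), sub_mul, mul_inv_cancel₀ hpos.ne', sub_smul]
    simp
  refine not_lipschitz_retraction_sphere (R := 2) (r := r) (K := C' * (1 + C)) (by norm_num)
    ?_ ?_ ?_ ?_
  · exact lipschitzOnWith_univ.1 (hC'.comp (lipschitzOnWith_univ.2 hlip) fun x _ => hhm x)
  · have hhd : Differentiable ℝ h := differentiable_id.add (hφd.differentiable one_ne_zero)
    have : ∀ x, h x ≠ 0 := fun x => norm_pos_iff.1 (hm.trans_le (hhm x))
    refine DifferentiableOn.congr (f := fun x => (2 * ‖h x‖⁻¹) • h x) ?_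
      fun x hx => hr x (by simpa using hx)
    intro x _
    exact (((((hhd x).norm ℝ (this x)).inv (norm_ne_zero_iff.2 (this x))).const_mul 2).smul
      (hhd x)).differentiableWithinAt
  · intro x hx
    have : h x = x := by simp [h, hφ0 x (by linarith)]
    simp [r, this, max_eq_left (sub_nonpos.2 hx)]
  · intro x hx
    have hpos : 0 < ‖h x‖ := hm.trans_le (hhm x)
    rw [hr x hx, norm_smul, norm_mul, norm_inv, norm_norm, mul_assoc, inv_mul_cancel₀ hpos.ne']
    norm_num

end NoRetraction

section InvarianceOfDomain

/-- The inverse of a continuous injective map on a compact set is continuous. -/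
theorem IsCompact.continuousOn_invFunOn {α β : Type*} [TopologicalSpace α] [Nonempty α]
    [TopologicalSpace β] [T2Space β] {f : α → β} {s : Set α} (hs : IsCompact s)
    (hf : ContinuousOn f s) (hinj : InjOn f s) :
    ContinuousOn (Function.invFunOn f s) (f '' s) := by
  rw [continuousOn_iff_isClosed]
  intro t ht
  refine ⟨f '' (s ∩ t), ((hs.inter_right ht).image_of_continuousOn
    (hf.mono inter_subset_left)).isClosed, ?_⟩
  ext y
  constructor
  · rintro ⟨hy, x, hx, rfl⟩
    rw [mem_preimage, hinj.leftInvOn_invFunOn hx] at hy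
    exact ⟨⟨x, ⟨hx, hy⟩, rfl⟩, x, hx, rfl⟩
  · rintro ⟨⟨x, ⟨hx, hxt⟩, rfl⟩, hy⟩
    refine ⟨?_, hy⟩
    rwa [mem_preimage, hinj.leftInvOn_invFunOn hx]

variable {E : Type*} [NormedAddCommGroup E] [InnerProductSpace ℝ E] [FiniteDimensional ℝ E]

theorem image_zero_mem_interior_image_closedBall {f : E → E}
    (hf : ContinuousOn f (closedBall 0 1)) (hinj : InjOn f (closedBall 0 1)) :
    f 0 ∈ interior (f '' closedBall 0 1) := by
  borelize E
  by_contra hint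
  set B := closedBall (0 : E) 1 with hB
  have h0B : (0 : E) ∈ B := by simp [hB]
  have hK : IsCompact (f '' B) := (isCompact_closedBall _ _).image_of_continuousOn hf
  have : TietzeExtension E := TietzeExtension.of_tvs ℝ
  obtain ⟨G, hG⟩ := ContinuousMap.exists_restrict_eq hK.isClosed
    ⟨(f '' B).domRestrict (Function.invFunOn f B),
      ((isCompact_closedBall _ _).continuousOn_invFunOn hf hinj).domRestrict⟩
  have hGf : ∀ x ∈ B, G (f x) = x := fun x hx =>
    (congrArg (fun k : C(f '' B, E) => k ⟨f x, x, hx, rfl⟩) hG).trans (hinj.leftInvOn_invFunOn hx)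
  obtain ⟨η, hη, hGη⟩ := Metric.continuousAt_iff.1 G.continuous.continuousAt (1 / 10)
    (by norm_num : (0 : ℝ) < 1 / 10)
  have hGη : ∀ y, dist y (f 0) < η → ‖G y‖ < 1 / 10 := fun y hy => by
    simpa [hGf 0 h0B] using hGη hy
  have hε : 0 < η / 4 := by positivity
  set ε := η / 4 with hεη
  obtain ⟨c, hcε, hcK⟩ : ∃ c, dist c (f 0) < ε ∧ c ∉ f '' B := by
    by_contra! hc
    exact hint (mem_interior_iff_mem_nhds.2 (Metric.mem_nhds_iff.2 ⟨ε, hε, fun y hy => hc y hy⟩))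
  have hGs : ∀ y, ‖y - c‖ ≤ ε → ‖G y‖ < 1 / 10 := fun y hy => by
    refine hGη y ((dist_triangle y c (f 0)).trans_lt ?_)
    rw [dist_eq_norm y c]
    linarith
  have hcompact : IsCompact (f '' B ∩ {y | ε ≤ ‖y - c‖}) :=
    hK.inter_right (isClosed_le continuous_const (by fun_prop))
  obtain ⟨δ, hδ, hGδ⟩ := hcompact.exists_forall_le' G.continuous.norm.continuousOn (a := 0) (by
    rintro _ ⟨⟨x, hx, rfl⟩, hxc⟩
    rw [hGf x hx, norm_pos_iff]
    rintro rfl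
    rw [dist_comm, dist_eq_norm] at hcε
    exact hcε.not_ge hxc)
  set δ' := min (δ / 2) (1 / 10) with hδ'
  have hδ'0 : 0 < δ' := by positivity
  obtain ⟨P, hP, hPG, -⟩ := G.continuous.exists_contDiff_approx 1
    (ε := fun _ => δ') continuous_const (fun _ => hδ'0)
  have hnull : volume (P '' sphere c ε) = 0 :=
    addHaar_image_eq_zero_of_differentiableOn_of_addHaar_eq_zero _
      (hP.differentiable one_ne_zero).differentiableOn
      (Measure.addHaar_sphere_of_ne_zero _ _ hε.ne')
  obtain ⟨v, hv, hvP⟩ : ∃ v ∈ ball (0 : E) δ', v ∉ P '' sphere c ε := by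
    by_contra! hc
    exact (measure_ball_pos volume (0 : E) hδ'0).ne' (measure_mono_null hc hnull)
  rw [mem_ball_zero_iff] at hv
  let Q : E → E := fun y => P y - v
  have hQG : ∀ y, ‖G y - Q y‖ < 2 * δ' := fun y => by
    have h1 := hPG y
    rw [dist_comm, dist_eq_norm] at h1
    have h2 := norm_add_le (G y - P y) v
    have h3 : G y - Q y = G y - P y + v := by simp only [Q]; abel
    rw [h3]
    linarith
  have hδ1 : δ' ≤ δ / 2 := min_le_left _ _
  have hδ2 : δ' ≤ 1 / 10 := min_le_right _ _
  let Φ : E → E := fun y => c + max 1 (ε * ‖y - c‖⁻¹) • (y - c)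
  have hne : ∀ x ∈ B, 0 < ‖f x - c‖ := fun x hx =>
    norm_pos_iff.2 (sub_ne_zero.2 fun h => hcK ⟨x, hx, h⟩)
  have hΦ1 : ∀ y, 0 < ‖y - c‖ → ε ≤ ‖y - c‖ → Φ y = y := fun y hy h => by
    have : ε * ‖y - c‖⁻¹ ≤ 1 := by rwa [← div_eq_mul_inv, div_le_one hy]
    simp [Φ, max_eq_left this]
  have hΦ2 : ∀ y, 0 < ‖y - c‖ → ‖y - c‖ ≤ ε → ‖Φ y - c‖ = ε := fun y hy h => by
    have : 1 ≤ ε * ‖y - c‖⁻¹ := by rwa [← div_eq_mul_inv, one_le_div hy]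
    simp only [Φ, max_eq_right this, add_sub_cancel_left, norm_smul, norm_mul, norm_inv,
      norm_norm, mul_assoc, inv_mul_cancel₀ hy.ne', mul_one, Real.norm_of_nonneg hε.le]
  have hcont : ContinuousOn (fun x => Q (Φ (f x))) B := by
    have hfc : ContinuousOn (fun x => f x - c) B := hf.sub continuousOn_const
    have hΦf : ContinuousOn (fun x => Φ (f x)) B :=
      continuousOn_const.add (ContinuousOn.smul (ContinuousOn.sup continuousOn_const
        (continuousOn_const.mul (hfc.norm.inv₀ fun x hx => (hne x hx).ne'))) hfc)
    exact (hP.continuous.sub continuous_const).comp_continuousOn hΦf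
  obtain ⟨x, hx, hx0⟩ := exists_zero_of_norm_sub_id_le hcont (fun x hx => by
    rw [norm_sub_rev]
    rcases le_total ε ‖f x - c‖ with h | h
    · rw [hΦ1 _ (hne x hx) h]
      nth_rewrite 1 [← hGf x hx]
      linarith [hQG (f x)]
    · have h1 := hQG (Φ (f x))
      have h2 := hGs (Φ (f x)) (hΦ2 _ (hne x hx) h).le
      have h3 := hGs (f x) h
      rw [hGf x hx] at h3
      have h4 : x - Q (Φ (f x)) = x - G (Φ (f x)) + (G (Φ (f x)) - Q (Φ (f x))) := by abel
      rw [h4]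
      linarith [norm_add_le (x - G (Φ (f x))) (G (Φ (f x)) - Q (Φ (f x))),
        norm_sub_le x (G (Φ (f x)))])
  rcases le_total ε ‖f x - c‖ with h | h
  · rw [hΦ1 _ (hne x hx) h] at hx0
    have h1 := hQG (f x)
    rw [hx0, sub_zero] at h1
    linarith [hGδ (f x) ⟨⟨x, hx, rfl⟩, h⟩]
  · exact hvP ⟨Φ (f x), by simpa [dist_eq_norm] using hΦ2 _ (hne x hx) h, sub_eq_zero.1 hx0⟩

/-- **Invariance of domain**: a continuous injective map sends interior points of a set to
interior points of its image. -/
theorem ContinuousOn.image_interior_subset_interior_image {f : E → E} {s : Set E}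
    (hf : ContinuousOn f s) (hinj : InjOn f s) : f '' interior s ⊆ interior (f '' s) := by
  rintro _ ⟨a, ha, rfl⟩
  obtain ⟨ρ, hρ, hs⟩ := Metric.nhds_basis_closedBall.mem_iff.1 (mem_interior_iff_mem_nhds.1 ha)
  let e : E → E := fun x => a + ρ • x
  have hes : MapsTo e (closedBall 0 1) s := fun x hx => hs (by
    rw [mem_closedBall_zero_iff] at hx
    simp only [e, mem_closedBall, dist_self_add_left, norm_smul, Real.norm_of_nonneg hρ.le]
    nlinarith)
  have he : Function.Injective e := fun x y h =>
    smul_right_injective E hρ.ne' (add_left_cancel h)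
  have h := image_zero_mem_interior_image_closedBall (f := f ∘ e)
    (hf.comp (by fun_prop) hes) (hinj.comp he.injOn hes)
  have h0 : (f ∘ e) 0 = f a := by simp [e]
  rw [h0, image_comp] at h
  exact interior_mono (image_mono hes.image_subset) h

theorem IsCompact.interior_image_of_injOn {f : E → E} {s : Set E} (hs : IsCompact s)
    (hf : ContinuousOn f s) (hinj : InjOn f s) : interior (f '' s) = f '' interior s := by
  refine Subset.antisymm (fun y hy => ?_) (hf.image_interior_subset_interior_image hinj)
  obtain ⟨x, hx, rfl⟩ := interior_subset hy
  have h := (hs.continuousOn_invFunOn hf hinj).image_interior_subset_interior_image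
    (Function.invFunOn_injOn_image f s) (mem_image_of_mem _ hy)
  rw [hinj.leftInvOn_invFunOn hx, hinj.leftInvOn_invFunOn.image_image] at h
  exact mem_image_of_mem f h

end InvarianceOfDomain

/-- For compact `X ⊆ ℝⁿ` and `F : ℝⁿ → ℝⁿ` continuous and injective on `X`,
the frontier of the image equals the image of the frontier: `∂(F(X)) = F(∂X)`. -/
theorem stmt_2 {n : ℕ} (X : Set (EuclideanSpace ℝ (Fin n)))
    (hXc : IsCompact X)
    (F : EuclideanSpace ℝ (Fin n) → EuclideanSpace ℝ (Fin n)) (hF : Continuous F)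
    (hinj : Set.InjOn F X) :
    frontier (F '' X) = F '' frontier X := by
  rw [(hXc.image hF).isClosed.frontier_eq, hXc.isClosed.frontier_eq,
    hXc.interior_image_of_injOn hF.continuousOn hinj, hinj.image_sdiff_subset interior_subset]
end

section
/- Let Ω be a compact subset of ℝⁿ (n ≥ 1), let Ω_u = {u ∈ ℝⁿ : u^min ≤ u ≤ u^max componentwise}, and let F : ℝⁿ → ℝⁿ be continuous. Assume ∂(F(Ω)) = F(∂Ω). Suppose there exists a unit vector λ̂ (‖λ̂‖ = 1) such that λ̂ᵀ(F(x) − u) ≤ 0 for every x ∈ Ω and u ∈ Ω_u (so the value z = min_{‖λ‖=1} max_{x∈Ω, u∈Ω_u} λᵀ(F(x) − u) is at most 0), and suppose there exist x₀ ∈ Ω and u₀ ∈ Ω_u with F(x₀) = u₀. Then there exist x ∈ ∂Ω and u ∈ Ω_u with F(x) = u; in particular, the system admits a solution on the frontier of Ω. -/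
open scoped RealInnerProductSpace

/-- A point of a set lying in a half-space bounded by a hyperplane through that point is not
interior to the set. -/
theorem notMem_interior_of_forall_inner_sub_nonpos {E : Type*} [NormedAddCommGroup E]
    [InnerProductSpace ℝ E] {S : Set E} {v u : E} (hv : v ≠ 0)
    (hS : ∀ y ∈ S, ⟪v, y - u⟫ ≤ 0) : u ∉ interior S := by
  intro hu
  have hcont : Filter.Tendsto (fun t : ℝ => u + t • v) (nhds 0) (nhds u) := by
    have h : Continuous fun t : ℝ => u + t • v := by fun_prop
    simpa using h.tendsto 0
  have hmem := hcont.eventually (mem_interior_iff_mem_nhds.mp hu)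
  obtain ⟨t, htS, ht⟩ :=
    ((hmem.filter_mono nhdsWithin_le_nhds).and
      (self_mem_nhdsWithin : Set.Ioi (0 : ℝ) ∈ nhdsWithin 0 (Set.Ioi 0))).exists
  have hle := hS _ htS
  rw [add_sub_cancel_left, real_inner_smul_right] at hle
  exact hle.not_gt (mul_pos ht (real_inner_self_pos.mpr hv))

/-- Outer-bound theorem: if a unit vector `lam` satisfies `lamᵀ(F(x) − u) ≤ 0` for all
`x ∈ Ω` and `u ∈ Ω_u` (so the min-max value is at most `0`), and the value `0` is
attained at some `x₀ ∈ Ω`, `u₀ ∈ Ω_u` with `F(x₀) = u₀`, then (assuming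
`∂(F(Ω)) = F(∂Ω)`) there is a solution on the frontier of `Ω`. -/
theorem stmt_7 {n : ℕ} (hn : 1 ≤ n)
    (Ω : Set (EuclideanSpace ℝ (Fin n))) (hΩc : IsCompact Ω)
    (umin umax : EuclideanSpace ℝ (Fin n))
    (Ωu : Set (EuclideanSpace ℝ (Fin n)))
    (hΩu : Ωu = {u | ∀ i, umin i ≤ u i ∧ u i ≤ umax i})
    (F : EuclideanSpace ℝ (Fin n) → EuclideanSpace ℝ (Fin n)) (hF : Continuous F)
    (hbd : frontier (F '' Ω) = F '' frontier Ω)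
    (lam : EuclideanSpace ℝ (Fin n)) (hlam : ‖lam‖ = 1)
    (hle : ∀ x ∈ Ω, ∀ u ∈ Ωu, ⟪lam, F x - u⟫ ≤ 0)
    (x₀ : EuclideanSpace ℝ (Fin n)) (hx₀ : x₀ ∈ Ω)
    (u₀ : EuclideanSpace ℝ (Fin n)) (hu₀ : u₀ ∈ Ωu)
    (heq : F x₀ = u₀) :
    ∃ x ∈ frontier Ω, ∃ u ∈ Ωu, F x = u := by
  have hlam_ne : lam ≠ 0 := norm_ne_zero_iff.mp (by rw [hlam]; exact one_ne_zero)
  have hfr : u₀ ∈ frontier (F '' Ω) :=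
    ⟨subset_closure ⟨x₀, hx₀, heq⟩,
      notMem_interior_of_forall_inner_sub_nonpos hlam_ne
        (Set.forall_mem_image.mpr fun x hx => hle x hx u₀ hu₀)⟩
  rw [hbd] at hfr
  obtain ⟨x, hx, hxu⟩ := hfr
  exact ⟨x, hx, u₀, hu₀, hxu⟩
end
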